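/- Let (p, n, θ, φ) be a smooth solution of the PNPF system with p, n, θ > 0, and let v^p, v^n be the associated velocities. Define the total energy density e = (c^p p + c^n n)θ + (p − n)φ/2. Then the pointwise identity ∂_t e = −∇·[(c^p + 1) p θ v^p + (c^n + 1) n θ v^n + p φ v^p − n φ v^n + (1/2)(φ_t ∇φ − φ ∇φ_t) − k∇θ] holds; consequently, for solutions with sufficient decay at spatial infinity, the total energy E(t) = ∫_{ℝ³} e(x,t) dx satisfies dE/dt = 0. -/

import Mathlib

open MeasureTheory Filter Topology Real

noncomputable section

/-- Euclidean space ℝ³. -/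
abbrev E3 : Type := EuclideanSpace ℝ (Fin 3)

/-- The `i`-th partial derivative `∂ᵢ f`. -/
def pd (i : Fin 3) (f : E3 → ℝ) (x : E3) : ℝ :=
  fderiv ℝ f x (EuclideanSpace.single i 1)

/-- The Laplacian `Δf`. -/
def lap (f : E3 → ℝ) (x : E3) : ℝ := ∑ i : Fin 3, pd i (pd i f) x

/-- The dot product of gradients `∇f · ∇g`. -/
def gdot (f g : E3 → ℝ) (x : E3) : ℝ := ∑ i : Fin 3, pd i f x * pd i g x

/-- The divergence `∇·F` of a vector field given componentwise. -/
def divv (F : Fin 3 → E3 → ℝ) (x : E3) : ℝ := ∑ i : Fin 3, pd i (F i) x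

/-- A smooth solution of the Poisson–Nernst–Planck–Fourier system on `ℝ³` with
mobilities `D^p, D^n`, heat conduction rate `k` and specific heats `c^p, c^n`:
`p_t + ∇·(p v^p) = 0` with `p v^p = -D^p[∇(pθ) + p∇φ]`;
`n_t + ∇·(n v^n) = 0` with `n v^n = -D^n[∇(nθ) - n∇φ]`;
`-Δφ = p - n` with `φ → 0` at infinity; and
`(c^p p + c^n n)θ_t + (c^p p v^p + c^n n v^n)·∇θ
  = ∇·(k∇θ) + p|v^p|²/D^p + n|v^n|²/D^n - pθ∇·v^p - nθ∇·v^n`. -/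
def IsFullPNPFSol (Dp Dn k cp cn : ℝ) (p n θ φ : ℝ → E3 → ℝ)
    (vp vn : ℝ → Fin 3 → E3 → ℝ) : Prop :=
  -- smoothness
  ContDiff ℝ (⊤ : ℕ∞) (fun q : ℝ × E3 => p q.1 q.2) ∧
  ContDiff ℝ (⊤ : ℕ∞) (fun q : ℝ × E3 => n q.1 q.2) ∧
  ContDiff ℝ (⊤ : ℕ∞) (fun q : ℝ × E3 => θ q.1 q.2) ∧
  ContDiff ℝ (⊤ : ℕ∞) (fun q : ℝ × E3 => φ q.1 q.2) ∧
  (∀ i : Fin 3, ContDiff ℝ (⊤ : ℕ∞) (fun q : ℝ × E3 => vp q.1 i q.2)) ∧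
  (∀ i : Fin 3, ContDiff ℝ (⊤ : ℕ∞) (fun q : ℝ × E3 => vn q.1 i q.2)) ∧
  -- positivity
  (∀ t : ℝ, ∀ x : E3, 0 < p t x ∧ 0 < n t x ∧ 0 < θ t x) ∧
  -- Darcy's law for the fluxes
  (∀ t : ℝ, ∀ x : E3, ∀ i : Fin 3,
      p t x * vp t i x =
        -(Dp * (pd i (fun y => p t y * θ t y) x + p t x * pd i (φ t) x))) ∧
  (∀ t : ℝ, ∀ x : E3, ∀ i : Fin 3,
      n t x * vn t i x =
        -(Dn * (pd i (fun y => n t y * θ t y) x - n t x * pd i (φ t) x))) ∧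
  -- conservation of mass
  (∀ t : ℝ, ∀ x : E3,
      deriv (fun s => p s x) t + divv (fun i y => p t y * vp t i y) x = 0) ∧
  (∀ t : ℝ, ∀ x : E3,
      deriv (fun s => n s x) t + divv (fun i y => n t y * vn t i y) x = 0) ∧
  -- the Poisson equation and decay of φ
  (∀ t : ℝ, ∀ x : E3, -lap (φ t) x = p t x - n t x) ∧
  (∀ t : ℝ, Tendsto (φ t) (cocompact E3) (nhds 0)) ∧
  -- the temperature equation
  (∀ t : ℝ, ∀ x : E3,
      (cp * p t x + cn * n t x) * deriv (fun s => θ s x) t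
        + (∑ i : Fin 3,
            (cp * p t x * vp t i x + cn * n t x * vn t i x) * pd i (θ t) x) =
      divv (fun i y => k * pd i (θ t) y) x
        + p t x * (∑ i : Fin 3, (vp t i x) ^ 2) / Dp
        + n t x * (∑ i : Fin 3, (vn t i x) ^ 2) / Dn
        - p t x * θ t x * divv (fun i y => vp t i y) x
        - n t x * θ t x * divv (fun i y => vn t i y) x)

section PartialDerivatives

variable {f g : E3 → ℝ} {x : E3} (i : Fin 3)

lemma pd_add (hf : DifferentiableAt ℝ f x) (hg : DifferentiableAt ℝ g x) :
    pd i (fun y => f y + g y) x = pd i f x + pd i g x := by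
  simp [pd, fderiv_fun_add hf hg]

lemma pd_sub (hf : DifferentiableAt ℝ f x) (hg : DifferentiableAt ℝ g x) :
    pd i (fun y => f y - g y) x = pd i f x - pd i g x := by
  simp [pd, fderiv_fun_sub hf hg]

lemma pd_mul (hf : DifferentiableAt ℝ f x) (hg : DifferentiableAt ℝ g x) :
    pd i (fun y => f y * g y) x = f x * pd i g x + pd i f x * g x := by
  simp [pd, fderiv_fun_mul hf hg, mul_comm]

lemma pd_const_mul (c : ℝ) (hf : DifferentiableAt ℝ f x) :
    pd i (fun y => c * f y) x = c * pd i f x := by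
  simp [pd, fderiv_const_mul hf]

end PartialDerivatives

section SpaceTime

variable {f : ℝ → E3 → ℝ}

lemma deriv_time_eq_fderiv (hf : Differentiable ℝ (fun q : ℝ × E3 => f q.1 q.2))
    (t : ℝ) (x : E3) :
    deriv (fun s => f s x) t = fderiv ℝ (fun q : ℝ × E3 => f q.1 q.2) (t, x) (1, 0) := by
  have hcurve : HasDerivAt (fun s : ℝ => (s, x)) ((1 : ℝ), (0 : E3)) t :=
    (hasDerivAt_id t).prodMk (hasDerivAt_const t x)
  exact ((hf (t, x)).hasFDerivAt.comp_hasDerivAt t hcurve).deriv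

lemma pd_eq_fderiv (hf : Differentiable ℝ (fun q : ℝ × E3 => f q.1 q.2))
    (i : Fin 3) (t : ℝ) (x : E3) :
    pd i (f t) x =
      fderiv ℝ (fun q : ℝ × E3 => f q.1 q.2) (t, x) (0, EuclideanSpace.single i 1) := by
  have hslice : HasFDerivAt (fun y : E3 => (t, y)) (ContinuousLinearMap.inr ℝ ℝ E3) x :=
    hasFDerivAt_prodMk_right t x
  have h : HasFDerivAt (f t) _ x := (hf (t, x)).hasFDerivAt.comp x hslice
  simp [pd, h.fderiv]

lemma contDiff_deriv_time (hf : ContDiff ℝ (⊤ : ℕ∞) (fun q : ℝ × E3 => f q.1 q.2)) :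
    ContDiff ℝ (⊤ : ℕ∞) (fun q : ℝ × E3 => deriv (fun s => f s q.2) q.1) := by
  simp only [deriv_time_eq_fderiv (hf.differentiable (by simp))]
  exact (hf.fderiv_right (by simp)).clm_apply contDiff_const

lemma contDiff_pd (hf : ContDiff ℝ (⊤ : ℕ∞) (fun q : ℝ × E3 => f q.1 q.2)) (i : Fin 3) :
    ContDiff ℝ (⊤ : ℕ∞) (fun q : ℝ × E3 => pd i (f q.1) q.2) := by
  simp only [pd_eq_fderiv (hf.differentiable (by simp))]
  exact (hf.fderiv_right (by simp)).clm_apply contDiff_const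

lemma differentiable_space (hf : ContDiff ℝ (⊤ : ℕ∞) (fun q : ℝ × E3 => f q.1 q.2)) (t : ℝ) :
    Differentiable ℝ (f t) :=
  (hf.comp (contDiff_prodMk_right t)).differentiable (by simp)

lemma differentiable_time (hf : ContDiff ℝ (⊤ : ℕ∞) (fun q : ℝ × E3 => f q.1 q.2)) (x : E3) :
    Differentiable ℝ (fun s => f s x) :=
  (hf.comp (contDiff_prodMk_left x)).differentiable (by simp)

/-- Time and space derivatives of a smooth function commute. -/
lemma deriv_pd_comm (hf : ContDiff ℝ (⊤ : ℕ∞) (fun q : ℝ × E3 => f q.1 q.2))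
    (i : Fin 3) (t : ℝ) (x : E3) :
    deriv (fun s => pd i (f s) x) t = pd i (fun z => deriv (fun s => f s z) t) x := by
  have hdiff := hf.differentiable (by simp)
  have hfd : Differentiable ℝ (fderiv ℝ (fun q : ℝ × E3 => f q.1 q.2)) :=
    (hf.fderiv_right (m := (⊤ : ℕ∞)) (by simp)).differentiable (by simp)
  rw [deriv_time_eq_fderiv (f := fun s y => pd i (f s) y)
      ((contDiff_pd hf i).differentiable (by simp)),
    pd_eq_fderiv (f := fun s z => deriv (fun r => f r z) s)
      ((contDiff_deriv_time hf).differentiable (by simp))]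
  simp only [pd_eq_fderiv hdiff, deriv_time_eq_fderiv hdiff]
  rw [fderiv_clm_apply (hfd _) (differentiableAt_const _),
    fderiv_clm_apply (hfd _) (differentiableAt_const _)]
  simpa using (hf.contDiffAt.isSymmSndFDerivAt
    (by
      rw [minSmoothness_of_isRCLikeNormedField]
      exact WithTop.coe_le_coe.mpr (le_top (a := (2 : ℕ∞))))).eq _ _

/-- The time derivative commutes with the Laplacian. -/
lemma deriv_lap_comm (hf : ContDiff ℝ (⊤ : ℕ∞) (fun q : ℝ × E3 => f q.1 q.2))
    (t : ℝ) (x : E3) :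
    deriv (fun s => lap (f s) x) t = lap (fun z => deriv (fun s => f s z) t) x := by
  have hdd i := differentiable_time (f := fun s y => pd i (pd i (f s)) y)
    (contDiff_pd (f := fun s y => pd i (f s) y) (contDiff_pd hf i) i) x
  simp only [lap]
  rw [deriv_fun_sum fun i _ => hdd i t]
  refine Finset.sum_congr rfl fun i _ => ?_
  rw [deriv_pd_comm (f := fun s y => pd i (f s) y) (contDiff_pd hf i)]
  simp only [deriv_pd_comm hf]

end SpaceTime

/-- **First Law of Thermodynamics for the PNPF system.** For a smooth positive
solution `(p, n, θ, φ)` with velocities `v^p, v^n`, the total energy density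
`e = (c^p p + c^n n)θ + (p - n)φ/2` satisfies the pointwise identity
`∂ₜe = -∇·[(c^p+1)pθv^p + (c^n+1)nθv^n + pφv^p - nφv^n
  + ½(φₜ∇φ - φ∇φₜ) - k∇θ]`;
consequently, for solutions with sufficient decay at spatial infinity (the flux
divergence integrates to zero and one may differentiate under the integral),
the total energy `E(t) = ∫ e dx` satisfies `dE/dt = 0`. -/
theorem pnpf_energy_conservation
    (Dp Dn k cp cn : ℝ) (hDp : 0 < Dp) (hDn : 0 < Dn) (hk : 0 < k)
    (hcp : 0 < cp) (hcn : 0 < cn)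
    (p n θ φ : ℝ → E3 → ℝ) (vp vn : ℝ → Fin 3 → E3 → ℝ)
    (hsol : IsFullPNPFSol Dp Dn k cp cn p n θ φ vp vn)
    (e : ℝ → E3 → ℝ)
    (he : e = fun t x =>
      (cp * p t x + cn * n t x) * θ t x + (p t x - n t x) * φ t x / 2)
    (F : ℝ → Fin 3 → E3 → ℝ)
    (hF : F = fun t i y =>
      (cp + 1) * p t y * θ t y * vp t i y + (cn + 1) * n t y * θ t y * vn t i y
        + p t y * φ t y * vp t i y - n t y * φ t y * vn t i y
        + (1 / 2) * (deriv (fun s => φ s y) t * pd i (φ t) y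
            - φ t y * pd i (fun z => deriv (fun s => φ s z) t) y)
        - k * pd i (θ t) y)
    -- sufficient decay at spatial infinity:
    (hflux : ∀ t : ℝ, ∫ x : E3, divv (F t) x = 0)
    (hswap : ∀ t : ℝ, HasDerivAt (fun s => ∫ x : E3, e s x)
        (∫ x : E3, deriv (fun s => e s x) t) t) :
    (∀ t : ℝ, ∀ x : E3, deriv (fun s => e s x) t = -divv (F t) x) ∧
    (∀ t : ℝ, deriv (fun s => ∫ x : E3, e s x) t = 0) := by
  obtain ⟨hp, hn, hθ, hφ, hvp, hvn, -, darcy_p, darcy_n, mass_p, mass_n, poisson, -, heat⟩ := hsol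
  have hpoint : ∀ t x, deriv (fun s => e s x) t = -divv (F t) x := by
    intro t x
    have time_e : deriv (fun s => e s x) t =
        (cp * deriv (fun s => p s x) t + cn * deriv (fun s => n s x) t) * θ t x
          + (cp * p t x + cn * n t x) * deriv (fun s => θ s x) t
          + ((deriv (fun s => p s x) t - deriv (fun s => n s x) t) * φ t x
            + (p t x - n t x) * deriv (fun s => φ s x) t) / 2 := by
      have p' := (differentiable_time hp x t).hasDerivAt
      have n' := (differentiable_time hn x t).hasDerivAt
      have θ' := (differentiable_time hθ x t).hasDerivAt
      have φ' := (differentiable_time hφ x t).hasDerivAt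
      rw [he]
      exact ((((p'.const_mul cp).add (n'.const_mul cn)).mul θ').add
        (((p'.sub n').mul φ').div_const 2)).deriv
    have poisson_t : -lap (fun z => deriv (fun s => φ s z) t) x =
        deriv (fun s => p s x) t - deriv (fun s => n s x) t := by
      rw [← deriv_lap_comm hφ, ← deriv_fun_sub (differentiable_time hp x t)
        (differentiable_time hn x t), ← deriv.fun_neg]
      simp only [poisson]
    have dp := differentiable_space hp t
    have dn := differentiable_space hn t
    have dθ := differentiable_space hθ t
    have dφ := differentiable_space hφ t
    have dvp i := differentiable_space (f := fun s y => vp s i y) (hvp i) t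
    have dvn i := differentiable_space (f := fun s y => vn s i y) (hvn i) t
    have dφt := differentiable_space (f := fun s y => deriv (fun r => φ r y) s)
      (contDiff_deriv_time hφ) t
    have dgθ i := differentiable_space (f := fun s y => pd i (θ s) y) (contDiff_pd hθ i) t
    have dgφ i := differentiable_space (f := fun s y => pd i (φ s) y) (contDiff_pd hφ i) t
    have dgφt i := differentiable_space
      (f := fun s y => pd i (fun z => deriv (fun r => φ r z) s) y)
      (contDiff_pd (f := fun s y => deriv (fun r => φ r y) s) (contDiff_deriv_time hφ) i) t
    have flux_p i : pd i (fun y => p t y * vp t i y) x =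
        p t x * pd i (vp t i) x + pd i (p t) x * vp t i x := pd_mul i (dp x) (dvp i x)
    have flux_n i : pd i (fun y => n t y * vn t i y) x =
        n t x * pd i (vn t i) x + pd i (n t) x * vn t i x := pd_mul i (dn x) (dvn i x)
    have pressure_p i : pd i (fun y => p t y * θ t y) x =
        p t x * pd i (θ t) x + pd i (p t) x * θ t x := pd_mul i (dp x) (dθ x)
    have pressure_n i : pd i (fun y => n t y * θ t y) x =
        n t x * pd i (θ t) x + pd i (n t) x * θ t x := pd_mul i (dn x) (dθ x)
    have dFp i : DifferentiableAt ℝ (fun y => p t y * vp t i y) x := (dp x).mul (dvp i x)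
    have dFn i : DifferentiableAt ℝ (fun y => n t y * vn t i y) x := (dn x).mul (dvn i x)
    have flux_e i : pd i (F t i) x =
        (cp + 1) * (θ t x * pd i (fun y => p t y * vp t i y) x
            + pd i (θ t) x * (p t x * vp t i x))
          + (cn + 1) * (θ t x * pd i (fun y => n t y * vn t i y) x
            + pd i (θ t) x * (n t x * vn t i x))
          + (φ t x * pd i (fun y => p t y * vp t i y) x
            + pd i (φ t) x * (p t x * vp t i x))
          - (φ t x * pd i (fun y => n t y * vn t i y) x
            + pd i (φ t) x * (n t x * vn t i x))
          + (1 / 2) * (deriv (fun s => φ s x) t * pd i (pd i (φ t)) x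
            - φ t x * pd i (pd i (fun z => deriv (fun s => φ s z) t)) x)
          - k * pd i (pd i (θ t)) x := by
      have hFi : F t i = fun y =>
          (cp + 1) * (θ t y * (p t y * vp t i y)) + (cn + 1) * (θ t y * (n t y * vn t i y))
            + φ t y * (p t y * vp t i y) - φ t y * (n t y * vn t i y)
            + (1 / 2) * (deriv (fun s => φ s y) t * pd i (φ t) y
                - φ t y * pd i (fun z => deriv (fun s => φ s z) t) y)
            - k * pd i (θ t) y := by
        rw [hF]; funext y; ring
      have aθp := (dθ x).fun_mul (dFp i)
      have aθn := (dθ x).fun_mul (dFn i)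
      have aφp := (dφ x).fun_mul (dFp i)
      have aφn := (dφ x).fun_mul (dFn i)
      have aφt := (dφt x).fun_mul (dgφ i x)
      have aφg := (dφ x).fun_mul (dgφt i x)
      have s1 := (aθp.const_mul (cp + 1)).fun_add (aθn.const_mul (cn + 1))
      have s2 := s1.fun_add aφp
      have s3 := s2.fun_sub aφn
      have s4 := s3.fun_add ((aφt.fun_sub aφg).const_mul (1 / 2))
      have s5 := (dgθ i x).const_mul k
      rw [hFi, pd_sub i s4 s5, pd_add i s3 ((aφt.fun_sub aφg).const_mul (1 / 2)),
        pd_sub i s2 aφn, pd_add i s1 aφp,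
        pd_add i (aθp.const_mul (cp + 1)) (aθn.const_mul (cn + 1)),
        pd_const_mul i _ aθp, pd_const_mul i _ aθn, pd_const_mul i _ (aφt.fun_sub aφg),
        pd_const_mul i _ (dgθ i x), pd_sub i aφt aφg,
        pd_mul i (dθ x) (dFp i), pd_mul i (dθ x) (dFn i), pd_mul i (dφ x) (dFp i),
        pd_mul i (dφ x) (dFn i), pd_mul i (dφt x) (dgφ i x), pd_mul i (dφ x) (dgφt i x)]
      ring
    have conduction i : pd i (fun y => k * pd i (θ t) y) x = k * pd i (pd i (θ t)) x :=
      pd_const_mul i k (dgθ i x)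
    have drag_p i : p t x * vp t i x / Dp =
        -(pd i (fun y => p t y * θ t y) x + p t x * pd i (φ t) x) := by
      rw [darcy_p]; field_simp
    have drag_n i : n t x * vn t i x / Dn =
        -(pd i (fun y => n t y * θ t y) x - n t x * pd i (φ t) x) := by
      rw [darcy_n]; field_simp
    simp only [pressure_p] at drag_p
    simp only [pressure_n] at drag_n
    have mp := mass_p t x
    have mn := mass_n t x
    have po := poisson t x
    have he' := heat t x
    simp only [divv, lap, Fin.sum_univ_three, flux_p, flux_n, conduction]
      at mp mn po he' poisson_t
    rw [time_e]
    simp only [divv, Fin.sum_univ_three, flux_e, flux_p, flux_n]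
    linear_combination he' + (cp * θ t x + φ t x) * mp + (cn * θ t x - φ t x) * mn
      + φ t x / 2 * poisson_t - deriv (fun s => φ s x) t / 2 * po
      + vp t 0 x * drag_p 0 + vp t 1 x * drag_p 1 + vp t 2 x * drag_p 2
      + vn t 0 x * drag_n 0 + vn t 1 x * drag_n 1 + vn t 2 x * drag_n 2
  refine ⟨hpoint, fun t => ?_⟩
  rw [(hswap t).deriv]
  simp only [hpoint, integral_neg, hflux, neg_zero]
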